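/- arXiv:2306.15343 — 2 statements merged into one kernel-verified Lean document; each statement's English description precedes it below -/
import Mathlib

section
/- Let A be a bounded self-adjoint operator and B a bounded positive contraction (0 ≤ B ≤ I) on a complex Hilbert space E, and let z be in the open unit disc with ζ(z) = (z+1)/(z−1). Then the operator iA + ζ(z)·B − I is invertible, and ψ(z) := (iA + ζ(z)B + I)·(iA + ζ(z)B − I)⁻¹ is a contraction (‖ψ(z)‖ ≤ 1) that does not have 1 as an eigenvalue. -/
open Complex Metric

/-- The Möbius map `z ↦ (z + 1) / (z - 1)` sends the unit disc to the left half-plane. -/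
lemma re_add_one_div_sub_one_nonpos {z : ℂ} (hz : ‖z‖ ≤ 1) : ((z + 1) / (z - 1)).re ≤ 0 := by
  have h : z.re * z.re + z.im * z.im ≤ 1 := by
    rw [← normSq_apply, normSq_eq_norm_sq]
    nlinarith [norm_nonneg z]
  rw [div_re, ← add_div]
  refine div_nonpos_of_nonpos_of_nonneg ?_ (normSq_nonneg _)
  simp only [add_re, add_im, sub_re, sub_im, one_re, one_im]
  nlinarith

section Dissipative

variable {E : Type*} [NormedAddCommGroup E] [InnerProductSpace ℂ E]

/-- A skew-adjoint operator plus a multiple of a positive operator by a scalar of nonpositive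
real part is dissipative. -/
lemma re_inner_I_smul_add_smul_nonpos [CompleteSpace E] {A B : E →L[ℂ] E} (hA : IsSelfAdjoint A)
    (hB : B.IsPositive) {c : ℂ} (hc : c.re ≤ 0) (x : E) :
    (inner ℂ x ((I • A + c • B) x)).re ≤ 0 := by
  have h1 : (inner ℂ x (A x)).im = 0 := by
    have h := hA.isSymmetric x x
    rw [ContinuousLinearMap.coe_coe, ← inner_conj_symm] at h
    exact conj_eq_iff_im.mp h
  have h2 : (inner ℂ x (B x)).im = 0 := by
    have h := hB.isSelfAdjoint.isSymmetric x x
    rw [ContinuousLinearMap.coe_coe, ← inner_conj_symm] at h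
    exact conj_eq_iff_im.mp h
  have h3 : 0 ≤ (inner ℂ x (B x)).re := hB.re_inner_nonneg_right x
  simp only [add_apply, smul_apply, inner_add_right, inner_smul_right, add_re, mul_re, I_re, I_im,
    h1, h2]
  nlinarith

/-- If `T` is dissipative, then `T - 1` is invertible. -/
lemma isUnit_sub_one_of_re_inner_nonpos [CompleteSpace E] {T : E →L[ℂ] E}
    (hT : ∀ x, (inner ℂ x (T x)).re ≤ 0) : IsUnit (T - 1) := by
  refine ContinuousLinearMap.isUnit_of_forall_le_norm_inner_map _ (c := 1) one_pos fun x ↦ ?_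
  have h : (inner ℂ x ((T - 1) x)).re = (inner ℂ x (T x)).re - ‖x‖ ^ 2 := by
    rw [sub_apply, one_apply_eq_self, inner_sub_right, sub_re]
    congr 1
    exact inner_self_eq_norm_sq (𝕜 := ℂ) x
  rw [norm_inner_symm]
  have h' := (abs_le.mp (abs_re_le_norm (inner ℂ x ((T - 1) x)))).1
  have := hT x
  simp only [NNReal.coe_one, mul_one]
  linarith

/-- If `T` is dissipative, then `‖(T + 1) x‖ ≤ ‖(T - 1) x‖`. -/
lemma norm_add_one_apply_le_norm_sub_one_apply {T : E →L[ℂ] E} {x : E}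
    (hT : (inner ℂ x (T x)).re ≤ 0) : ‖(T + 1) x‖ ≤ ‖(T - 1) x‖ := by
  have h1 := norm_add_sq (𝕜 := ℂ) (T x) x
  have h2 := norm_sub_sq (𝕜 := ℂ) (T x) x
  rw [inner_re_symm] at h1 h2
  simp only [RCLike.re_to_complex] at h1 h2
  refine le_of_sq_le_sq ?_ (norm_nonneg _)
  simp only [add_apply, sub_apply, one_apply_eq_self]
  linarith

/-- The Cayley transform of a dissipative operator is a contraction. -/
lemma norm_add_one_mul_inverse_sub_one_le [CompleteSpace E] {T : E →L[ℂ] E}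
    (hT : ∀ x, (inner ℂ x (T x)).re ≤ 0) : ‖(T + 1) * Ring.inverse (T - 1)‖ ≤ 1 := by
  refine ContinuousLinearMap.opNorm_le_bound _ zero_le_one fun x ↦ ?_
  have h : (T - 1) (Ring.inverse (T - 1) x) = x :=
    DFunLike.congr_fun (Ring.mul_inverse_cancel _ (isUnit_sub_one_of_re_inner_nonpos hT)) x
  have := norm_add_one_apply_le_norm_sub_one_apply (hT (Ring.inverse (T - 1) x))
  rwa [h, ← one_mul ‖x‖] at this

/-- `1` is not an eigenvalue of a Cayley transform. -/
lemma eq_zero_of_add_one_mul_inverse_sub_one_apply_eq {T : E →L[ℂ] E} (hT : IsUnit (T - 1)) {x : E}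
    (hx : ((T + 1) * Ring.inverse (T - 1)) x = x) : x = 0 := by
  have h : (T - 1) (Ring.inverse (T - 1) x) = x :=
    DFunLike.congr_fun (Ring.mul_inverse_cancel _ hT) x
  set y := Ring.inverse (T - 1) x
  have hx' : (T + 1) y = (T - 1) y := hx.trans h.symm
  simp only [add_apply, sub_apply, one_apply_eq_self] at hx'
  have hy : (2 : ℂ) • y = 0 := by
    rw [two_smul]
    calc y + y = (T y + y) - (T y - y) := by abel
      _ = 0 := by rw [hx', sub_self]
  have hy0 : y = 0 := (smul_eq_zero.mp hy).resolve_left two_ne_zero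
  rw [← h, hy0, map_zero]

end Dissipative

/-- For `A` self-adjoint, `B` a positive contraction and `z ∈ 𝔻`, with `ζ(z) = (z+1)/(z-1)`,
the operator `iA + ζ(z)B - I` is invertible and
`ψ(z) = (iA + ζ(z)B + I)(iA + ζ(z)B - I)⁻¹` is a contraction without eigenvalue `1`. -/
theorem stmt_9 {E : Type*} [NormedAddCommGroup E] [InnerProductSpace ℂ E] [CompleteSpace E]
    (A B : E →L[ℂ] E) (hA : IsSelfAdjoint A) (hB : B.IsPositive)
    (hB1 : (1 - B).IsPositive) (z : ℂ) (hz : z ∈ ball (0 : ℂ) 1) :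
    IsUnit (Complex.I • A + ((z + 1) / (z - 1)) • B - 1) ∧
    ‖(Complex.I • A + ((z + 1) / (z - 1)) • B + 1) *
        Ring.inverse (Complex.I • A + ((z + 1) / (z - 1)) • B - 1)‖ ≤ 1 ∧
    ∀ x : E, ((Complex.I • A + ((z + 1) / (z - 1)) • B + 1) *
        Ring.inverse (Complex.I • A + ((z + 1) / (z - 1)) • B - 1)) x = x → x = 0 := by
  have hT := re_inner_I_smul_add_smul_nonpos hA hB
    (re_add_one_div_sub_one_nonpos (mem_ball_zero_iff.mp hz).le)
  have hU := isUnit_sub_one_of_re_inner_nonpos hT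
  exact ⟨hU, norm_add_one_mul_inverse_sub_one_le hT,
    fun _ ↦ eq_zero_of_add_one_mul_inverse_sub_one_apply_eq hU⟩
end

section
/- Every extreme point of the convex set P = {f : 𝔻 → ℂ holomorphic, Re f > 0, f(0) = 1} is of the form f(z) = (1 + e^{iθ}z)/(1 − e^{iθ}z) for some θ ∈ [0, 2π), and conversely every such function is an extreme point of P. -/
open Complex Metric

open scoped ComplexConjugate Topology

/-- If `f` is the Herglotz transform of a measure `μ` on the circle, this is the Herglotz
transform of the measure `Re (α ζ) dμ(ζ)`. -/
noncomputable def herglotzTilt (α : ℂ) (f : ℂ → ℂ) (z : ℂ) : ℂ :=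
  (α * (z * f z + z + conj (deriv f 0) / 2) + conj α * (dslope f 0 z - deriv f 0 / 2)) / 2

theorem re_add_tilt (α u w b : ℂ) :
    (u + (α * (w * u + w + conj b / 2) + conj α * (conj w * (u - 1) - b / 2)) / 2).re =
      u.re * (1 + (α * w).re) := by
  simp
  ring

theorem re_nonneg_of_re_nonneg_on_sphere {F : ℂ → ℂ} (hF : DiffContOnCl ℂ F (ball 0 1))
    (h : ∀ w ∈ sphere (0 : ℂ) 1, 0 ≤ (F w).re) {z : ℂ} (hz : z ∈ ball (0 : ℂ) 1) :
    0 ≤ (F z).re := by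
  have hd : DiffContOnCl ℂ (fun z ↦ exp (-F z)) (ball 0 1) :=
    differentiable_exp.comp_diffContOnCl hF.neg
  have := Complex.norm_le_of_forall_mem_frontier_norm_le (C := 1) isBounded_ball hd
    (fun w hw ↦ by
      rw [frontier_ball _ one_ne_zero] at hw
      simpa [norm_exp] using h w hw) (subset_closure hz)
  simpa [norm_exp] using this

theorem differentiableOn_herglotzTilt (α : ℂ) {f : ℂ → ℂ} (hf : DifferentiableOn ℂ f (ball 0 1)) :
    DifferentiableOn ℂ (herglotzTilt α f) (ball 0 1) := by
  have hs : DifferentiableOn ℂ (dslope f 0) (ball 0 1) :=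
    (Complex.differentiableOn_dslope (ball_mem_nhds _ one_pos)).2 hf
  unfold herglotzTilt
  fun_prop

theorem re_add_herglotzTilt_nonneg {α : ℂ} (hα : ‖α‖ = 1) {f : ℂ → ℂ}
    (hf : DifferentiableOn ℂ f (ball 0 1)) (hpos : ∀ z ∈ ball (0 : ℂ) 1, 0 < (f z).re)
    (h0 : f 0 = 1) {z : ℂ} (hz : z ∈ ball (0 : ℂ) 1) : 0 ≤ (f z + herglotzTilt α f z).re := by
  have hs : DifferentiableOn ℂ (dslope f 0) (ball 0 1) :=
    (Complex.differentiableOn_dslope (ball_mem_nhds _ one_pos)).2 hf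
  let F : ℝ → ℂ → ℂ := fun r w ↦ f (r * w) +
    (α * (w * f (r * w) + w + conj (r * deriv f 0) / 2) +
      conj α * (r * dslope f 0 (r * w) - r * deriv f 0 / 2)) / 2
  have key : ∀ r ∈ Set.Ioo (0 : ℝ) 1, 0 ≤ (F r z).re := by
    rintro r ⟨hr0, hr1⟩
    have hmaps : Set.MapsTo (fun w : ℂ ↦ (r : ℂ) * w) (closedBall 0 1) (ball 0 1) := by
      intro w hw
      simp only [mem_closedBall, mem_ball, dist_zero_right, norm_mul, norm_real,
        Real.norm_eq_abs, abs_of_pos hr0] at hw ⊢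
      nlinarith
    have hm : DifferentiableOn ℂ (fun w : ℂ ↦ (r : ℂ) * w) (closedBall 0 1) := by fun_prop
    have hfr : DifferentiableOn ℂ (fun w : ℂ ↦ f (r * w)) (closedBall 0 1) := hf.comp hm hmaps
    have hsr : DifferentiableOn ℂ (fun w : ℂ ↦ dslope f 0 (r * w)) (closedBall 0 1) :=
      hs.comp hm hmaps
    have hF : DifferentiableOn ℂ (F r) (closedBall 0 1) := by
      simp only [F]
      fun_prop
    refine re_nonneg_of_re_nonneg_on_sphere
      (DifferentiableOn.diffContOnCl (by rwa [closure_ball _ one_ne_zero])) ?_ hz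
    intro w hw
    have hw1 : ‖w‖ = 1 := by simpa using hw
    have hw0 : w ≠ 0 := by
      rintro rfl
      simp at hw1
    have hr0' : (r : ℂ) ≠ 0 := ofReal_ne_zero.2 hr0.ne'
    have hslope : r * dslope f 0 (r * w) = conj w * (f (r * w) - 1) := by
      rw [dslope_of_ne _ (mul_ne_zero hr0' hw0), slope_def_field, h0, sub_zero,
        ← Complex.inv_eq_conj hw1]
      field_simp
    have hre : -1 ≤ (α * w).re := by
      have := Complex.abs_re_le_norm (α * w)
      rw [norm_mul, hα, hw1, one_mul] at this
      exact (abs_le.1 this).1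
    simp only [F]
    rw [hslope, re_add_tilt]
    exact mul_nonneg (hpos _ (hmaps (sphere_subset_closedBall hw))).le (by linarith)
  have hcast : ContinuousAt (fun r : ℝ ↦ (r : ℂ) * z) 1 := by fun_prop
  have hnhds : ball (0 : ℂ) 1 ∈ 𝓝 (((1 : ℝ) : ℂ) * z) := by
    simpa using isOpen_ball.mem_nhds hz
  have hfc : ContinuousAt (fun r : ℝ ↦ f (r * z)) 1 :=
    ContinuousAt.comp (f := fun r : ℝ ↦ (r : ℂ) * z) (hf.continuousOn.continuousAt hnhds) hcast
  have hsc : ContinuousAt (fun r : ℝ ↦ dslope f 0 (r * z)) 1 :=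
    ContinuousAt.comp (f := fun r : ℝ ↦ (r : ℂ) * z) (hs.continuousOn.continuousAt hnhds) hcast
  have hconj : ContinuousAt (fun r : ℝ ↦ conj ((r : ℂ) * deriv f 0)) 1 :=
    continuous_conj.continuousAt.comp (by fun_prop)
  have hFc : ContinuousAt (fun r : ℝ ↦ (F r z).re) 1 := by
    have hr : ContinuousAt (fun r : ℝ ↦ (r : ℂ)) 1 := continuous_ofReal.continuousAt
    exact continuous_re.continuousAt.comp (g := re) <| hfc.add <|
      ((((hfc.const_mul z).add continuousAt_const).add (hconj.div_const 2)).const_mul α |>.add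
        (((hr.mul hsc).sub ((hr.mul continuousAt_const).div_const 2)).const_mul (conj α))).div_const
        2
  have hlim := hFc.tendsto.mono_left (nhdsWithin_le_nhds (s := Set.Iio 1))
  have := ge_of_tendsto hlim
    (Filter.eventually_of_mem (Ioo_mem_nhdsLT one_pos) key)
  simpa [F, herglotzTilt] using this

theorem herglotzTilt_neg (α : ℂ) (f : ℂ → ℂ) (z : ℂ) :
    herglotzTilt (-α) f z = -herglotzTilt α f z := by
  simp only [herglotzTilt, map_neg]
  ring

theorem herglotzTilt_zero (α : ℂ) (f : ℂ → ℂ) :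
    herglotzTilt α f 0 = (((α * conj (deriv f 0)).re / 2 : ℝ) : ℂ) := by
  apply Complex.ext <;> simp [herglotzTilt] <;> ring

/-- An extreme point of the Herglotz class is an eigenvector of every tilt. -/
theorem herglotzTilt_eq_of_extreme {P : Set (ℂ → ℂ)}
    (hP : P = {f : ℂ → ℂ | DifferentiableOn ℂ f (ball (0 : ℂ) 1) ∧
      (∀ z ∈ ball (0 : ℂ) 1, 0 < (f z).re) ∧ f 0 = 1}) {f : ℂ → ℂ} (hf : f ∈ P)
    (hext : ∀ g ∈ P, ∀ h ∈ P, (∀ z ∈ ball (0 : ℂ) 1, f z = (g z + h z) / 2) →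
      ∀ z ∈ ball (0 : ℂ) 1, g z = f z ∧ h z = f z)
    {α : ℂ} (hα : ‖α‖ = 1) {z : ℂ} (hz : z ∈ ball (0 : ℂ) 1) :
    herglotzTilt α f z = herglotzTilt α f 0 * f z := by
  subst hP
  obtain ⟨hd, hpos, h0⟩ := hf
  obtain ⟨l, hl⟩ : ∃ l : ℝ, herglotzTilt α f 0 = l := ⟨_, herglotzTilt_zero α f⟩
  obtain ⟨e, he0, he⟩ : ∃ e : ℝ, 0 < e ∧ e * (2 + |l|) = 1 :=
    ⟨(2 + |l|)⁻¹, by positivity, inv_mul_cancel₀ (by positivity)⟩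
  have hT := differentiableOn_herglotzTilt α hd
  have hmem : ∀ s : ℝ, |s| = 1 → (fun z ↦ f z + s * e * (herglotzTilt α f z - l * f z)) ∈
      {f : ℂ → ℂ | DifferentiableOn ℂ f (ball (0 : ℂ) 1) ∧
        (∀ z ∈ ball (0 : ℂ) 1, 0 < (f z).re) ∧ f 0 = 1} := by
    intro s hs
    refine ⟨by fun_prop, fun w hw ↦ ?_, by simp [hl, h0]⟩
    have h1 : 0 ≤ (f w).re + s * (herglotzTilt α f w).re := by
      have hp := re_add_herglotzTilt_nonneg hα hd hpos h0 hw
      have hn := re_add_herglotzTilt_nonneg (α := -α) (by simpa using hα) hd hpos h0 hw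
      rw [herglotzTilt_neg] at hn
      rcases eq_or_eq_neg_of_abs_eq hs with rfl | rfl <;> simp at hp hn ⊢ <;> linarith
    have h2 : s * l ≤ |l| := by
      calc s * l ≤ |s * l| := le_abs_self _
        _ = |l| := by rw [abs_mul, hs, one_mul]
    have h3 := mul_le_mul_of_nonneg_left h2 he0.le
    have hval : (f w + s * e * (herglotzTilt α f w - l * f w)).re =
        (1 - e * (s * l) - e) * (f w).re + e * ((f w).re + s * (herglotzTilt α f w).re) := by
      simp
      ring
    rw [hval]
    have := mul_pos (show 0 < 1 - e * (s * l) - e by nlinarith) (hpos w hw)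
    have := mul_nonneg he0.le h1
    linarith
  have := (hext _ (hmem 1 (by simp)) _ (hmem (-1) (by simp))
    (fun w _ ↦ by push_cast; ring) z hz).1
  rw [hl]
  have he0' : (e : ℂ) ≠ 0 := ofReal_ne_zero.2 he0.ne'
  simpa [he0', sub_eq_zero] using this

theorem exists_angle_of_norm_eq_one {η : ℂ} (hη : ‖η‖ = 1) :
    ∃ θ : ℝ, 0 ≤ θ ∧ θ < 2 * Real.pi ∧ exp (I * θ) = η := by
  have h : exp (I * arg η) = η := by
    rw [mul_comm]
    simpa [hη] using norm_mul_exp_arg_mul_I η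
  rcases le_or_gt 0 (arg η) with h0 | h0
  · exact ⟨arg η, h0, by linarith [arg_le_pi η, Real.pi_pos], h⟩
  · refine ⟨arg η + 2 * Real.pi, by linarith [neg_pi_lt_arg η, Real.pi_pos], by linarith, ?_⟩
    push_cast
    rw [mul_add, exp_add, mul_comm I (2 * _), exp_two_pi_mul_I, mul_one, h]

theorem one_sub_mul_ne_zero {η z : ℂ} (hη : ‖η‖ = 1) (hz : z ∈ ball (0 : ℂ) 1) :
    1 - η * z ≠ 0 := by
  intro h
  have : ‖η * z‖ = 1 := by rw [← sub_eq_zero.1 h, norm_one]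
  rw [norm_mul, hη, one_mul] at this
  simp [this] at hz

theorem re_add_one_ne_zero {u : ℂ} (h : 0 < u.re) : u + 1 ≠ 0 := fun h' ↦ by
  have := congrArg re h'
  simp at this
  linarith

/-- The Cayley transform of a function in the Herglotz class is a self-map of the disc. -/
theorem mapsTo_cayley {g : ℂ → ℂ} (hpos : ∀ z ∈ ball (0 : ℂ) 1, 0 < (g z).re) :
    Set.MapsTo (fun z ↦ (g z - 1) / (g z + 1)) (ball 0 1) (ball 0 1) := by
  intro z hz
  have h := hpos z hz
  rw [mem_ball_zero_iff, norm_div, div_lt_one (norm_pos_iff.2 (re_add_one_ne_zero h))]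
  refine lt_of_pow_lt_pow_left₀ 2 (norm_nonneg _) ?_
  simp only [Complex.sq_norm, normSq_apply, sub_re, sub_im, add_re, add_im, one_re, one_im]
  nlinarith

theorem differentiableOn_cayley {g : ℂ → ℂ} (hd : DifferentiableOn ℂ g (ball 0 1))
    (hpos : ∀ z ∈ ball (0 : ℂ) 1, 0 < (g z).re) :
    DifferentiableOn ℂ (fun z ↦ (g z - 1) / (g z + 1)) (ball 0 1) :=
  (hd.sub_const 1).div (hd.add_const 1) fun z hz ↦ re_add_one_ne_zero (hpos z hz)

theorem deriv_cayley {g : ℂ → ℂ} (hd : DifferentiableOn ℂ g (ball 0 1)) (h0 : g 0 = 1) :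
    deriv (fun z ↦ (g z - 1) / (g z + 1)) 0 = deriv g 0 / 2 := by
  have hg := (hd.differentiableAt (ball_mem_nhds 0 one_pos)).hasDerivAt
  have := ((hg.sub_const 1).div (hg.add_const 1) (by rw [h0]; norm_num)).deriv
  refine this.trans ?_
  rw [h0]
  ring

theorem norm_deriv_le_two {g : ℂ → ℂ} (hd : DifferentiableOn ℂ g (ball 0 1))
    (hpos : ∀ z ∈ ball (0 : ℂ) 1, 0 < (g z).re) (h0 : g 0 = 1) : ‖deriv g 0‖ ≤ 2 := by
  have := Complex.norm_deriv_le_one_of_mapsTo_ball (differentiableOn_cayley hd hpos)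
    (by simpa [h0] using (mapsTo_cayley hpos).mono_right ball_subset_closedBall) one_pos
  rw [deriv_cayley hd h0, norm_div] at this
  norm_num at this
  linarith

theorem eq_of_deriv_eq {g : ℂ → ℂ} (hd : DifferentiableOn ℂ g (ball 0 1))
    (hpos : ∀ z ∈ ball (0 : ℂ) 1, 0 < (g z).re) (h0 : g 0 = 1) {η : ℂ} (hη : ‖η‖ = 1)
    (hderiv : deriv g 0 = 2 * η) {z : ℂ} (hz : z ∈ ball (0 : ℂ) 1) :
    g z = (1 + η * z) / (1 - η * z) := by
  have hc : deriv (fun z ↦ (g z - 1) / (g z + 1)) 0 = η := by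
    rw [deriv_cayley hd h0, hderiv]
    ring
  have := Complex.affine_of_mapsTo_ball_of_norm_dslope_eq_div (R₂ := 1)
    (differentiableOn_cayley hd hpos)
    (by simpa [h0] using (mapsTo_cayley hpos).mono_right ball_subset_closedBall)
    (mem_ball_self one_pos) (by rw [dslope_same, hc, hη, div_one]) hz
  simp only [dslope_same, hc, h0, sub_self, zero_div, zero_add, sub_zero, smul_eq_mul] at this
  rw [div_eq_iff (re_add_one_ne_zero (hpos z hz))] at this
  rw [eq_div_iff (one_sub_mul_ne_zero hη hz)]
  linear_combination this

theorem deriv_herglotz_kernel (η : ℂ) :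
    deriv (fun z : ℂ ↦ (1 + η * z) / (1 - η * z)) 0 = 2 * η := by
  have hm : HasDerivAt (fun z : ℂ ↦ η * z) η 0 := by
    simpa using (hasDerivAt_id (0 : ℂ)).const_mul η
  have := ((hm.const_add 1).div (hm.const_sub 1) (by simp)).deriv
  refine this.trans ?_
  simp
  ring

theorem eq_of_add_eq_of_norm_le {a b c : ℂ} (ha : ‖a‖ ≤ ‖c‖) (hb : ‖b‖ ≤ ‖c‖)
    (h : a + b = 2 * c) : a = c := by
  have hpar := parallelogram_law_with_norm ℝ a b
  rw [h, norm_mul, Complex.norm_ofNat] at hpar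
  have hab : ‖a - b‖ = 0 := by
    refine pow_eq_zero_iff two_ne_zero |>.1 (le_antisymm ?_ (sq_nonneg _))
    nlinarith [norm_nonneg a, norm_nonneg b]
  have := sub_eq_zero.1 (norm_eq_zero.1 hab)
  subst this
  linear_combination h / 2

/-- The extreme points of the normalized Herglotz class
`P = {f : 𝔻 → ℂ holomorphic, Re f > 0, f(0) = 1}` are exactly the functions
`z ↦ (1 + e^{iθ} z)/(1 - e^{iθ} z)`, `θ ∈ [0, 2π)`. -/
theorem stmt_19 (P : Set (ℂ → ℂ))
    (hP : P = {f : ℂ → ℂ | DifferentiableOn ℂ f (ball (0 : ℂ) 1) ∧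
      (∀ z ∈ ball (0 : ℂ) 1, 0 < (f z).re) ∧ f 0 = 1}) :
    ∀ f ∈ P,
      ((∀ g ∈ P, ∀ h ∈ P, (∀ z ∈ ball (0 : ℂ) 1, f z = (g z + h z) / 2) →
          ∀ z ∈ ball (0 : ℂ) 1, g z = f z ∧ h z = f z) ↔
        ∃ θ : ℝ, 0 ≤ θ ∧ θ < 2 * Real.pi ∧ ∀ z ∈ ball (0 : ℂ) 1,
          f z = (1 + Complex.exp (Complex.I * (θ : ℂ)) * z) /
            (1 - Complex.exp (Complex.I * (θ : ℂ)) * z)) := by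
  intro f hf
  constructor
  · intro hext
    have heig {α : ℂ} (hα : ‖α‖ = 1) {z : ℂ} (hz : z ∈ ball (0 : ℂ) 1) :=
      herglotzTilt_eq_of_extreme hP hf hext hα hz
    subst hP
    obtain ⟨hd, hpos, h0⟩ := hf
    obtain ⟨m, hm⟩ : ∃ m, m = deriv f 0 / 2 := ⟨_, rfl⟩
    have hder : deriv f 0 = 2 * m := by rw [hm]; ring
    have hA : ∀ z ∈ ball (0 : ℂ) 1, z * f z + z + conj m = conj m * f z ∧
        dslope f 0 z - m = m * f z := by
      intro z hz
      have h1 := heig (α := 1) (by simp) hz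
      have h2 := heig (α := I) (by simp) hz
      simp only [herglotzTilt, dslope_same, hder, h0, map_one, map_mul, conj_I, map_ofNat] at h1 h2
      constructor
      · linear_combination h1 - I * h2 + ((z * f z + z + conj m) / 2 - (dslope f 0 z - m) / 2
          - (conj m - m) * f z / 2) * I_sq
      · linear_combination h1 + I * h2 + (-(z * f z + z + conj m) / 2 + (dslope f 0 z - m) / 2
          + (conj m - m) * f z / 2) * I_sq
    have hB : ∀ z ∈ ball (0 : ℂ) 1, f z * (1 - m * z) = 1 + m * z := by
      intro z hz
      have h1 := (hA z hz).2
      have h2 : z * dslope f 0 z = f z - 1 := by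
        simpa [h0] using sub_smul_dslope f 0 z
      linear_combination z * h1 - h2
    have hnorm : ‖m‖ = 1 := by
      have hz : (1 / 2 : ℂ) ∈ ball (0 : ℂ) 1 := by
        rw [mem_ball_zero_iff]
        norm_num
      have h1 := (hA _ hz).1
      have h2 := hB _ hz
      have h3 : (m * conj m - 1) * (f (1 / 2) + 1) = 0 := by
        linear_combination -2 * conj m * h2 - 2 * h1
      have h4 := (mul_eq_zero.1 h3).resolve_right (re_add_one_ne_zero (hpos _ hz))
      rw [mul_conj', sub_eq_zero] at h4
      have h5 : ‖m‖ ^ 2 = 1 := by exact_mod_cast h4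
      exact (pow_eq_one_iff_of_nonneg (norm_nonneg m) two_ne_zero).1 h5
    obtain ⟨θ, hθ0, hθ1, hθ⟩ := exists_angle_of_norm_eq_one hnorm
    refine ⟨θ, hθ0, hθ1, fun z hz ↦ ?_⟩
    rw [hθ, eq_div_iff (one_sub_mul_ne_zero hnorm hz), hB z hz]
  · rintro ⟨θ, -, -, hθ⟩ g hg h hh hgh
    subst hP
    obtain ⟨hgd, hgpos, hg0⟩ := hg
    obtain ⟨hhd, hhpos, hh0⟩ := hh
    obtain ⟨η, hη⟩ : ∃ η, η = exp (I * θ) := ⟨_, rfl⟩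
    have hnorm : ‖η‖ = 1 := by rw [hη, norm_exp_I_mul_ofReal]
    rw [← hη] at hθ
    have hnhds := ball_mem_nhds (0 : ℂ) one_pos
    have hsum : deriv g 0 + deriv h 0 = 2 * (2 * η) := by
      have hfun : (fun z : ℂ ↦ (1 + η * z) / (1 - η * z)) =ᶠ[𝓝 0] fun z ↦ (g z + h z) / 2 := by
        filter_upwards [hnhds] with z hz
        rw [← hθ z hz, hgh z hz]
      have hsumd := (((hgd.differentiableAt hnhds).hasDerivAt.add
        (hhd.differentiableAt hnhds).hasDerivAt).div_const 2).deriv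
      have := (deriv_herglotz_kernel η).symm.trans (hfun.deriv_eq.trans hsumd)
      linear_combination -2 * this
    have hη2 : ‖2 * η‖ = 2 := by simp [hnorm]
    have hgle := hη2 ▸ norm_deriv_le_two hgd hgpos hg0
    have hhle := hη2 ▸ norm_deriv_le_two hhd hhpos hh0
    have hge := eq_of_add_eq_of_norm_le hgle hhle hsum
    have hhe := eq_of_add_eq_of_norm_le hhle hgle (by rw [add_comm, hsum])
    intro z hz
    rw [hθ z hz]
    exact ⟨eq_of_deriv_eq hgd hgpos hg0 hnorm hge hz, eq_of_deriv_eq hhd hhpos hh0 hnorm hhe hz⟩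
end
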